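/- Let R_i be a partial row over m candidates in normal form of parameters k_1 = 0 and k_2 (so only the last k_2 positions are locked), and suppose the fixed candidate w does not appear among the locked entries. Then the total score margin of w satisfies Δ(R_i) = −(m − 1 − k_2)² + k_2(k_2 + 1)/2. -/

import Mathlib

section Defs

variable {n m : ℕ} {C : Type*}

/-- A partial row (partial ballot): each candidate appears at most once. -/
def IsPartialRow (r : Fin m → Option C) : Prop :=
  ∀ ⦃k k' : Fin m⦄ ⦃c : C⦄, r k = some c → r k' = some c → k = k'

/-- `q` is a completion of the partial row `r` (a bijection from positions to
candidates agreeing with `r` on all non-null entries). -/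
def IsCompletion (r : Fin m → Option C) (q : Fin m ≃ C) : Prop :=
  ∀ ⦃k : Fin m⦄ ⦃c : C⦄, r k = some c → q k = c

/-- Number of non-null (locked) entries of a partial row. -/
def rowSize (r : Fin m → Option C) : ℕ :=
  (Finset.univ.filter fun k : Fin m => (r k).isSome).card

/-- A partial rank matrix: each candidate appears at most once in every row. -/
def IsPartialMat (R : Fin n → Fin m → Option C) : Prop :=
  ∀ i, IsPartialRow (R i)

/-- `Q` is a complete extension of the partial rank matrix `R`:
each row of `Q` is a bijection from positions to candidates
agreeing with the corresponding row of `R` on all non-null entries. -/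
def IsMatCompletion (R : Fin n → Fin m → Option C) (Q : Fin n → Fin m ≃ C) : Prop :=
  ∀ i, IsCompletion (R i) (Q i)

/-- Number of non-null (locked) entries of a partial rank matrix. -/
def matSize (R : Fin n → Fin m → Option C) : ℕ := ∑ i, rowSize (R i)

/-- `R ⊆ R'` : the partial rank matrix `R'` extends the partial rank matrix `R`. -/
def PExt (R R' : Fin n → Fin m → Option C) : Prop :=
  ∀ i k c, R i k = some c → R' i k = some c

/-- `w` is a necessary winner of the partial rank matrix `X` under voting rule `F`. -/
def NecessaryWinner (F : (Fin n → Fin m ≃ C) → Set C)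
    (X : Fin n → Fin m → Option C) (w : C) : Prop :=
  ∀ Q : Fin n → Fin m ≃ C, IsMatCompletion X Q → w ∈ F Q

/-- `R∖Y` : the partial rank matrix obtained from the complete rank matrix `R` by
erasing (making null) the entries locked in `Y`. -/
def matDiff (R : Fin n → Fin m ≃ C) (Y : Fin n → Fin m → Option C) :
    Fin n → Fin m → Option C :=
  fun i k => if (Y i k).isSome then none else some (R i k)

/-- Borda score of candidate `c` in the complete row `q` :
a candidate in position `k+1` (index `k`) scores `m - (k+1)`. -/
def bordaRowScore (q : Fin m ≃ C) (c : C) : ℤ := (m : ℤ) - 1 - ((q.symm c : ℕ) : ℤ)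

/-- Minimal Borda score of `c` over all completions of the partial row `r`. -/
noncomputable def rowSMin (r : Fin m → Option C) (c : C) : ℤ :=
  sInf {x : ℤ | ∃ q : Fin m ≃ C, IsCompletion r q ∧ bordaRowScore q c = x}

/-- Maximal Borda score of `c` over all completions of the partial row `r`. -/
noncomputable def rowSMax (r : Fin m → Option C) (c : C) : ℤ :=
  sSup {x : ℤ | ∃ q : Fin m ≃ C, IsCompletion r q ∧ bordaRowScore q c = x}

/-- Total score margin `Δ(r) = Σ_{c' ≠ w} (σmin_r(w) − σmax_r(c'))` of `w` in the
partial row `r`, under Borda weights. -/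
noncomputable def rowDelta [Fintype C] [DecidableEq C]
    (r : Fin m → Option C) (w : C) : ℤ :=
  ∑ c ∈ Finset.univ.filter (fun c : C => c ≠ w), (rowSMin r w - rowSMax r c)

/-- Borda score of candidate `c` in the complete rank matrix `Q`. -/
def bordaScore (Q : Fin n → Fin m ≃ C) (c : C) : ℤ := ∑ i, bordaRowScore (Q i) c

/-- `w ∈ Borda(Q)` : `w` has maximal Borda score in the complete rank matrix `Q`. -/
def IsBordaWinner (Q : Fin n → Fin m ≃ C) (w : C) : Prop :=
  ∀ c, bordaScore Q c ≤ bordaScore Q w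

/-- Score of candidate `c` in the complete rank matrix `Q` under the scoring rule
with weight vector `wt`. -/
def scoreW (wt : Fin m → ℝ) (Q : Fin n → Fin m ≃ C) (c : C) : ℝ :=
  ∑ i, wt ((Q i).symm c)

/-- `σmin_R(c)` : minimal score of `c` over all complete extensions of `R`. -/
noncomputable def matSMinW (wt : Fin m → ℝ) (R : Fin n → Fin m → Option C) (c : C) : ℝ :=
  sInf {x : ℝ | ∃ Q : Fin n → Fin m ≃ C, IsMatCompletion R Q ∧ scoreW wt Q c = x}

/-- `σmax_R(c)` : maximal score of `c` over all complete extensions of `R`. -/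
noncomputable def matSMaxW (wt : Fin m → ℝ) (R : Fin n → Fin m → Option C) (c : C) : ℝ :=
  sSup {x : ℝ | ∃ Q : Fin n → Fin m ≃ C, IsMatCompletion R Q ∧ scoreW wt Q c = x}

/-- `σmin_{R_i}(c)` : minimal score of `c` over all completions of the single row `r`. -/
noncomputable def rowSMinW (wt : Fin m → ℝ) (r : Fin m → Option C) (c : C) : ℝ :=
  sInf {x : ℝ | ∃ q : Fin m ≃ C, IsCompletion r q ∧ wt (q.symm c) = x}

/-- `σmax_{R_i}(c)` : maximal score of `c` over all completions of the single row `r`. -/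
noncomputable def rowSMaxW (wt : Fin m → ℝ) (r : Fin m → Option C) (c : C) : ℝ :=
  sSup {x : ℝ | ∃ q : Fin m ≃ C, IsCompletion r q ∧ wt (q.symm c) = x}

/-- `r` is in normal form of parameters `k1, k2`: a position `p = k+1` is null
exactly when `k1 < p < m + 1 - k2`. -/
def IsNormalForm (r : Fin m → Option C) (k1 k2 : ℕ) : Prop :=
  ∀ k : Fin m, r k = none ↔ (k1 < (k : ℕ) + 1 ∧ (k : ℕ) + 1 < m + 1 - k2)

end Defs

theorem IsPartialRow.exists_isCompletion {m : ℕ} {C : Type*} [Fintype C] [DecidableEq C]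
    (hC : Fintype.card C = m) {r : Fin m → Option C} (hr : IsPartialRow r) (w : C) :
    ∃ q : Fin m ≃ C, IsCompletion r q := by
  obtain ⟨g, hg⟩ := Finset.exists_equiv_extend_of_card_eq (α := Fin m) (β := C)
    (t := Finset.univ) (by simp [hC])
    (s := Finset.univ.filter fun k => (r k).isSome) (f := fun k => (r k).getD w)
    (Finset.subset_univ _) (by
      intro k hk k' hk' h
      simp only [Finset.coe_filter, Finset.mem_univ, true_and, Set.mem_ofPred_eq,
        Option.isSome_iff_exists] at hk hk'
      obtain ⟨c, hc⟩ := hk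
      obtain ⟨c', hc'⟩ := hk'
      simp only [hc, hc', Option.getD_some] at h
      exact hr hc (h ▸ hc'))
  refine ⟨g.trans (Equiv.subtypeUnivEquiv Finset.mem_univ), fun k c hk => ?_⟩
  have h := hg k (by simp [hk])
  simpa [hk] using h

theorem IsCompletion.swap_trans {m : ℕ} {C : Type*} {r : Fin m → Option C} {q : Fin m ≃ C}
    (hq : IsCompletion r q) {i j : Fin m} (hi : r i = none) (hj : r j = none) :
    IsCompletion r ((Equiv.swap i j).trans q) := by
  intro k c hk
  have hki : k ≠ i := by rintro rfl; simp [hi] at hk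
  have hkj : k ≠ j := by rintro rfl; simp [hj] at hk
  simpa [Equiv.swap_apply_of_ne_of_ne hki hkj] using hq hk

theorem bordaRowScore_swap_trans {m : ℕ} {C : Type*} (q : Fin m ≃ C) (i j : Fin m) :
    bordaRowScore ((Equiv.swap i j).trans q) (q i) = (m : ℤ) - 1 - ((j : ℕ) : ℤ) := by
  simp [bordaRowScore]

/-- A candidate in a free position of one completion is in a free position of all of them. -/
theorem IsCompletion.symm_eq_none {m : ℕ} {C : Type*} {r : Fin m → Option C} {q q' : Fin m ≃ C}
    (hq : IsCompletion r q) (hq' : IsCompletion r q') {i : Fin m} (hi : r i = none) :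
    r (q'.symm (q i)) = none := by
  by_contra h
  obtain ⟨c, hc⟩ := Option.ne_none_iff_exists'.mp h
  have h1 := hq hc
  have h2 := hq' hc
  simp only [Equiv.apply_symm_apply] at h2
  rw [← h2] at h1
  rw [q.injective h1, hi] at hc
  simp at hc

theorem IsCompletion.rowSMin_free {m : ℕ} {C : Type*} {r : Fin m → Option C} {q : Fin m ≃ C}
    (hq : IsCompletion r q) {i j : Fin m} (hi : r i = none) (hj : r j = none)
    (hmax : ∀ k, r k = none → k ≤ j) :
    rowSMin r (q i) = (m : ℤ) - 1 - ((j : ℕ) : ℤ) := by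
  refine IsLeast.csInf_eq ⟨⟨_, hq.swap_trans hi hj, bordaRowScore_swap_trans q i j⟩, ?_⟩
  rintro x ⟨q', hq', rfl⟩
  have := Fin.le_def.mp (hmax _ (hq.symm_eq_none hq' hi))
  unfold bordaRowScore
  omega

theorem IsCompletion.rowSMax_free {m : ℕ} {C : Type*} {r : Fin m → Option C} {q : Fin m ≃ C}
    (hq : IsCompletion r q) {i j : Fin m} (hi : r i = none) (hj : r j = none)
    (hmin : ∀ k, r k = none → j ≤ k) :
    rowSMax r (q i) = (m : ℤ) - 1 - ((j : ℕ) : ℤ) := by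
  refine IsGreatest.csSup_eq ⟨⟨_, hq.swap_trans hi hj, bordaRowScore_swap_trans q i j⟩, ?_⟩
  rintro x ⟨q', hq', rfl⟩
  have := Fin.le_def.mp (hmin _ (hq.symm_eq_none hq' hi))
  unfold bordaRowScore
  omega

theorem IsCompletion.rowSMax_locked {m : ℕ} {C : Type*} {r : Fin m → Option C} {q : Fin m ≃ C}
    (hq : IsCompletion r q) {i : Fin m} (hi : r i ≠ none) :
    rowSMax r (q i) = (m : ℤ) - 1 - ((i : ℕ) : ℤ) := by
  obtain ⟨c, hc⟩ := Option.ne_none_iff_exists'.mp hi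
  have hqi := hq hc
  refine IsGreatest.csSup_eq ⟨⟨q, hq, by simp [bordaRowScore]⟩, ?_⟩
  rintro x ⟨q', hq', rfl⟩
  have : q'.symm (q i) = i := by rw [Equiv.symm_apply_eq, hqi, hq' hc]
  simp [bordaRowScore, this]

/- STATEMENT 13 -/
theorem stmt13 {m : ℕ} {C : Type*} [Fintype C] [DecidableEq C]
    (hm : 2 ≤ m) (hC : Fintype.card C = m)
    (r : Fin m → Option C) (hr : IsPartialRow r) (w : C)
    (k2 : ℕ) (hnf : IsNormalForm r 0 k2) (hk2 : k2 ≤ m)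
    (hw : ∀ k : Fin m, r k ≠ some w) :
    rowDelta r w = -((m : ℤ) - 1 - k2) ^ 2 + (k2 * (k2 + 1) : ℤ) / 2 := by
  obtain ⟨q, hq⟩ := hr.exists_isCompletion hC w
  obtain ⟨p, rfl⟩ := q.surjective w
  have hfree : ∀ k : Fin m, r k = none ↔ (k : ℕ) + k2 < m := fun k => by
    rw [hnf k]; omega
  have hp : r p = none := by
    by_contra h
    obtain ⟨c, hc⟩ := Option.ne_none_iff_exists'.mp h
    exact hw p (by rw [hc, hq hc])
  have hlt := (hfree p).mp hp
  have hmin : rowSMin r (q p) = k2 := by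
    rw [hq.rowSMin_free (j := ⟨m - 1 - k2, by omega⟩) hp ((hfree _).mpr (by simp only; omega))
      fun k hk => Fin.le_def.mpr (by have := (hfree k).mp hk; simp only; omega)]
    simp only
    omega
  have hmax : ∀ k : Fin m, rowSMax r (q k) =
      if (k : ℕ) + k2 < m then (m : ℤ) - 1 else (m : ℤ) - 1 - ((k : ℕ) : ℤ) := fun k => by
    split_ifs with h
    · rw [hq.rowSMax_free (j := ⟨0, by omega⟩) ((hfree k).mpr h)
        ((hfree _).mpr (by simp only; omega)) fun k _ => Fin.le_def.mpr (Nat.zero_le _)]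
      simp
    · exact hq.rowSMax_locked (mt (hfree k).mp h)
  obtain ⟨a, rfl⟩ := Nat.exists_eq_add_of_le' hk2
  have hall : ∑ c, (rowSMin r (q p) - rowSMax r c)
      = a * ((1 : ℤ) - a) + (k2 * (k2 + 1) : ℤ) / 2 := by
    rw [← q.sum_comp]
    simp only [hmin, hmax]
    rw [Fin.sum_univ_eq_sum_range (fun k : ℕ => (k2 : ℤ) -
      if k + k2 < a + k2 then ((a + k2 : ℕ) : ℤ) - 1 else ((a + k2 : ℕ) : ℤ) - 1 - (k : ℤ)),
      Finset.sum_range_add]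
    congr 1
    · rw [Finset.sum_congr rfl (g := fun _ => (1 : ℤ) - a)]
      · simp [mul_sub]
      · intro k hk
        rw [Finset.mem_range] at hk
        rw [if_pos (by omega)]
        push_cast; ring
    · rw [Finset.sum_congr rfl (g := fun k : ℕ => (k : ℤ) + 1)]
      · have gauss : ∀ n : ℕ, (∑ k ∈ Finset.range n, ((k : ℤ) + 1)) * 2 = n * (n + 1) := by
          intro n
          induction n with
          | zero => simp
          | succ n ih => rw [Finset.sum_range_succ, add_mul, ih]; push_cast; ring
        rw [← gauss, Int.mul_ediv_cancel _ two_ne_zero]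
      · intro k _
        rw [if_neg (by omega)]
        push_cast; ring
  have hsplit := Finset.sum_erase_add Finset.univ
    (fun c => rowSMin r (q p) - rowSMax r c) (Finset.mem_univ (q p))
  simp only [hmax p, if_pos hlt] at hsplit
  rw [hall, hmin] at hsplit
  rw [rowDelta, Finset.filter_ne', hmin]
  push_cast at hsplit ⊢
  linear_combination hsplit
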